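/- Conditioned walk estimate: let h be a potential on a recurrent rooted network, v≠o a vertex, M>0, and 0<j<d(o,v). Then P_o( h(X_j) ≥ M | τ_v < τ_o^+ ) ≤ h(v)/M, where X is the network random walk from o, τ_v the hitting time of v, and τ_o^+ the first return time to o. -/

import Mathlib

open scoped Classical
open Filter Topology MeasureTheory ProbabilityTheory

/-- A weighted network: an infinite, connected, locally finite graph with
positive edge conductances, encoded by a symmetric conductance function. -/
structure Network (V : Type*) where
  c : V → V → ℝ
  symm : ∀ x y, c x y = c y x
  nonneg : ∀ x y, 0 ≤ c x y
  locFin : ∀ x, {y | 0 < c x y}.Finite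
  conn : ∀ x y, Relation.ReflTransGen (fun a b => 0 < c a b) x y
  deg_pos : ∀ x, 0 < ∑' y, c x y
  infinite : Infinite V

namespace Network

variable {V : Type*} (N : Network V)

/-- Total conductance at a vertex. -/
noncomputable def cTot (x : V) : ℝ := ∑' y, N.c x y

/-- One-step transition probabilities of the network random walk. -/
noncomputable def p (x y : V) : ℝ := N.c x y / N.cTot x

/-- `n`-step transition probabilities of the network random walk. -/
noncomputable def pstep : ℕ → V → V → ℝ
  | 0, x, y => if x = y then 1 else 0
  | n + 1, x, y => ∑' z, pstep n x z * N.p z y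

/-- The network random walk is recurrent: the expected number of returns is infinite. -/
def Recurrent : Prop := ∀ x : V, ¬ Summable (fun n => N.pstep n x x)

/-- `avoid A n x y` is the probability that the walk started at `x` is at `y` at time `n`
without having visited the set `A` at any time `0,…,n`, i.e. `P_x(X_n = y, τ_A > n)`. -/
noncomputable def avoid (A : Set V) : ℕ → V → V → ℝ
  | 0, x, y => if x = y ∧ x ∉ A then 1 else 0
  | n + 1, x, y => if y ∈ A then 0 else ∑' z, avoid A n x z * N.p z y

/-- Green kernel of the walk killed at `o`:  `G_o(x,y) = Σ_n P_x(X_n = y, τ_o > n)`. -/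
noncomputable def GreenK (o x y : V) : ℝ := ∑' n, N.avoid {o} n x y

/-- Green density of the walk killed at `o`:  `g_o(x,y) = G_o(x,y)/c_y`. -/
noncomputable def g (o x y : V) : ℝ := N.GreenK o x y / N.cTot y

/-- The network Laplacian `Δf(v) = Σ_x c_{vx}(f(x) − f(v))`. -/
noncomputable def lap (f : V → ℝ) (v : V) : ℝ := ∑' x, N.c v x * (f x - f v)

/-- A potential on the rooted network `(G,c,o)`: a nonnegative function vanishing at `o`,
with Laplacian `1` at `o` and harmonic elsewhere. -/
def IsPotential (o : V) (h : V → ℝ) : Prop :=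
  (∀ v, 0 ≤ h v) ∧ h o = 0 ∧ N.lap h o = 1 ∧ ∀ v, v ≠ o → N.lap h v = 0

/-- Harmonic measure from `v` on a set `A`:  `ω_v^A(z) = P_v(X_{τ_A} = z)`. -/
noncomputable def harm (A : Set V) (v z : V) : ℝ :=
  if v ∈ A then (if v = z then 1 else 0)
  else if z ∈ A then ∑' n, ∑' w, N.avoid A n v w * N.p w z
  else 0

/-- Effective resistance `R_eff(x ↔ y) = g_x(y,y)`. -/
noncomputable def Reff (x y : V) : ℝ := N.g x y y

/-- Transition probabilities of the Doob `h`-transform: `p^h(x,y) = p(x,y) h(y)/h(x)`. -/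
noncomputable def ph (h : V → ℝ) (x y : V) : ℝ := N.p x y * h y / h x

/-- `n`-step transition probabilities of the `h`-process. -/
noncomputable def phstep (h : V → ℝ) : ℕ → V → V → ℝ
  | 0, x, y => if x = y then 1 else 0
  | n + 1, x, y => ∑' z, phstep h n x z * N.ph h z y

/-- The initial distribution `μ_h(v) = c_{ov} h(v)`. -/
noncomputable def muh (o : V) (h : V → ℝ) (v : V) : ℝ := N.c o v * h v

end Network

/-- `P` is the law of the Markov chain with initial distribution `μ` and transition
probabilities `q`, as a measure on trajectory space. -/
def IsChainLaw {S : Type*} [MeasurableSpace S] (μ : S → ℝ) (q : S → S → ℝ)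
    (P : MeasureTheory.Measure (ℕ → S)) : Prop :=
  ∀ (n : ℕ) (v : ℕ → S),
    P {ω | ∀ i ≤ n, ω i = v i} =
      ENNReal.ofReal (μ (v 0) * ∏ i ∈ Finset.range n, q (v i) (v (i + 1)))


namespace Network

section Op
variable {V : Type*} (N : Network V)

/-- The finite set of neighbours. -/
noncomputable def nb (x : V) : Finset V := (N.locFin x).toFinset

lemma mem_nb {x y : V} : y ∈ N.nb x ↔ 0 < N.c x y := by simp [nb]

lemma c_eq_zero {x y : V} (hy : y ∉ N.nb x) : N.c x y = 0 := by
  rw [mem_nb] at hy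
  exact le_antisymm (not_lt.mp hy) (N.nonneg x y)

lemma cTot_pos (x : V) : 0 < N.cTot x := N.deg_pos x

lemma cTot_eq (x : V) : N.cTot x = ∑ y ∈ N.nb x, N.c x y :=
  tsum_eq_sum fun _ hy => N.c_eq_zero hy

lemma p_nonneg (x y : V) : 0 ≤ N.p x y := div_nonneg (N.nonneg x y) (N.cTot_pos x).le

lemma p_eq_zero {x y : V} (hy : y ∉ N.nb x) : N.p x y = 0 := by
  simp [p, N.c_eq_zero hy]

lemma p_pos {x y : V} (hy : y ∈ N.nb x) : 0 < N.p x y :=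
  div_pos (N.mem_nb.1 hy) (N.cTot_pos x)

lemma cTot_mul_p (x y : V) : N.cTot x * N.p x y = N.c x y := by
  have := (N.cTot_pos x).ne'
  unfold p; field_simp

/-- The transition operator. -/
noncomputable def op : (V → ℝ) →ₗ[ℝ] (V → ℝ) where
  toFun g x := ∑ y ∈ N.nb x, N.p x y * g y
  map_add' f g := by ext x; simp [mul_add, Finset.sum_add_distrib]
  map_smul' a g := by ext x; simp [Finset.mul_sum, mul_left_comm]

lemma op_apply (g : V → ℝ) (x : V) : N.op g x = ∑ y ∈ N.nb x, N.p x y * g y := rfl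

/-- Killing at `o`. -/
noncomputable def kill (o : V) : (V → ℝ) →ₗ[ℝ] (V → ℝ) where
  toFun g x := if x = o then 0 else g x
  map_add' f g := by ext x; by_cases hx : x = o <;> simp [hx]
  map_smul' a g := by ext x; by_cases hx : x = o <;> simp [hx]

lemma kill_apply (o : V) (g : V → ℝ) (x : V) : kill o g x = if x = o then 0 else g x := rfl

/-- The killed operator. -/
noncomputable def Q (o : V) : Module.End ℝ (V → ℝ) := kill o ∘ₗ N.op

/-- Operator which kills before averaging. -/
noncomputable def K (o : V) : Module.End ℝ (V → ℝ) := N.op ∘ₗ kill o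

lemma Q_apply (o : V) (g : V → ℝ) (x : V) : N.Q o g x = if x = o then 0 else N.op g x := rfl

lemma K_apply (o : V) (g : V → ℝ) : N.K o g = N.op (kill o g) := rfl

/-- Dirac mass. -/
noncomputable def dl (o : V) : V → ℝ := fun x => if x = o then 1 else 0

lemma op_mono {f g : V → ℝ} (hfg : ∀ x, f x ≤ g x) (x : V) : N.op f x ≤ N.op g x :=
  Finset.sum_le_sum fun y _ => mul_le_mul_of_nonneg_left (hfg y) (N.p_nonneg x y)

lemma op_nonneg {f : V → ℝ} (hf : ∀ x, 0 ≤ f x) (x : V) : 0 ≤ N.op f x :=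
  Finset.sum_nonneg fun y _ => mul_nonneg (N.p_nonneg x y) (hf y)

lemma op_one (x : V) : N.op (fun _ => 1) x = 1 := by
  have h := (N.cTot_pos x).ne'
  simp only [op_apply, mul_one, p]
  rw [← Finset.sum_div, ← cTot_eq, div_self h]

lemma op_le_one {f : V → ℝ} (hf : ∀ x, f x ≤ 1) (x : V) : N.op f x ≤ 1 :=
  (N.op_mono hf x).trans (N.op_one x).le

lemma kill_mono (o : V) {f g : V → ℝ} (hfg : ∀ x, f x ≤ g x) (x : V) :
    kill o f x ≤ kill o g x := by
  simp only [kill_apply]; split_ifs <;> simp [hfg]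

lemma Q_mono (o : V) {f g : V → ℝ} (hfg : ∀ x, f x ≤ g x) (x : V) :
    N.Q o f x ≤ N.Q o g x := kill_mono o (N.op_mono hfg) x

lemma K_mono (o : V) {f g : V → ℝ} (hfg : ∀ x, f x ≤ g x) (x : V) :
    N.K o f x ≤ N.K o g x := N.op_mono (kill_mono o hfg) x

lemma pow_mono (T : Module.End ℝ (V → ℝ))
    (hT : ∀ f g : V → ℝ, (∀ x, f x ≤ g x) → ∀ x, T f x ≤ T g x) (n : ℕ) :
    ∀ {f g : V → ℝ}, (∀ x, f x ≤ g x) → ∀ x, (T ^ n) f x ≤ (T ^ n) g x := by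
  induction n with
  | zero => intro f g h; simpa using h
  | succ n ih =>
    intro f g h x
    rw [pow_succ', Module.End.mul_apply, Module.End.mul_apply]
    exact hT _ _ (ih h) x

lemma op_tendsto {f : ℕ → V → ℝ} {g : V → ℝ}
    (hf : ∀ x, Tendsto (fun n => f n x) atTop (𝓝 (g x))) (x : V) :
    Tendsto (fun n => N.op (f n) x) atTop (𝓝 (N.op g x)) := by
  simp only [op_apply]
  exact tendsto_finsetSum _ fun y _ => (hf y).const_mul _

lemma kill_tendsto (o : V) {f : ℕ → V → ℝ} {g : V → ℝ}
    (hf : ∀ x, Tendsto (fun n => f n x) atTop (𝓝 (g x))) (x : V) :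
    Tendsto (fun n => kill o (f n) x) atTop (𝓝 (kill o g x)) := by
  simp only [kill_apply]
  split_ifs
  · exact tendsto_const_nhds
  · exact hf x

lemma K_pow_tendsto (o : V) {f : ℕ → V → ℝ} {g : V → ℝ}
    (hf : ∀ x, Tendsto (fun n => f n x) atTop (𝓝 (g x))) (j : ℕ) : ∀ (x : V),
    Tendsto (fun n => (N.K o ^ j) (f n) x) atTop (𝓝 ((N.K o ^ j) g x)) := by
  induction j with
  | zero => simpa using hf
  | succ j ih =>
    intro x
    simp only [pow_succ', Module.End.mul_apply]
    exact N.op_tendsto (kill_tendsto o ih) x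

/-- The weighted pairing. -/
noncomputable def pr (f g : V → ℝ) : ℝ := ∑' x, N.cTot x * f x * g x

lemma pr_eq_sum {f : V → ℝ} (g : V → ℝ) (s : Finset V) (hs : ∀ x, x ∉ s → f x = 0) :
    N.pr f g = ∑ x ∈ s, N.cTot x * f x * g x :=
  tsum_eq_sum fun x hx => by simp [hs x hx]

/-- Finite support. -/
def FS (f : V → ℝ) : Prop := ∃ s : Finset V, ∀ x, x ∉ s → f x = 0

lemma FS_op {f : V → ℝ} (hf : FS f) : FS (N.op f) := by
  obtain ⟨s, hs⟩ := hf
  refine ⟨s.biUnion N.nb, fun x hx => Finset.sum_eq_zero fun y hy => ?_⟩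
  rw [hs y, mul_zero]
  intro hys
  apply hx
  rw [Finset.mem_biUnion]
  refine ⟨y, hys, ?_⟩
  rw [mem_nb] at hy ⊢
  rwa [N.symm]

lemma FS_kill (o : V) {f : V → ℝ} (hf : FS f) : FS (kill o f) := by
  obtain ⟨s, hs⟩ := hf
  exact ⟨s, fun x hx => by simp [kill_apply, hs x hx]⟩

lemma FS_Q (o : V) {f : V → ℝ} (hf : FS f) : FS (N.Q o f) := FS_kill o (N.FS_op hf)

lemma FS_Q_pow (o : V) {f : V → ℝ} (hf : FS f) (n : ℕ) : FS ((N.Q o ^ n) f) := by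
  induction n with
  | zero => simpa using hf
  | succ n ih =>
    rw [pow_succ', Module.End.mul_apply]
    exact N.FS_Q o ih

lemma FS_dl (o : V) : FS (dl o) := ⟨{o}, fun x hx => by simpa [dl] using hx⟩

lemma op_apply_of_supp {f : V → ℝ} (s : Finset V) (hs : ∀ x, x ∉ s → f x = 0) (x : V) :
    N.op f x = ∑ y ∈ s, N.p x y * f y := by
  have h1 : N.op f x = ∑' y, N.p x y * f y :=
    (tsum_eq_sum fun y hy => by rw [N.p_eq_zero hy, zero_mul]).symm
  rw [h1]
  exact tsum_eq_sum fun y hy => by rw [hs y hy, mul_zero]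

lemma pr_op {f : V → ℝ} (hf : FS f) (g : V → ℝ) : N.pr (N.op f) g = N.pr f (N.op g) := by
  obtain ⟨s, hs⟩ := hf
  have ht : ∀ x, x ∉ s.biUnion N.nb → N.op f x = 0 := by
    intro x hx
    rw [N.op_apply_of_supp s hs]
    refine Finset.sum_eq_zero fun y hy => ?_
    rw [N.p_eq_zero, zero_mul]
    intro hyx
    apply hx
    rw [Finset.mem_biUnion]
    refine ⟨y, hy, ?_⟩
    rw [mem_nb] at hyx ⊢
    rwa [N.symm]
  rw [N.pr_eq_sum g _ ht, N.pr_eq_sum _ s hs]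
  have h1 : ∀ x, N.cTot x * N.op f x * g x = ∑ y ∈ s, N.c x y * f y * g x := by
    intro x
    rw [N.op_apply_of_supp s hs, Finset.mul_sum, Finset.sum_mul]
    refine Finset.sum_congr rfl fun y _ => ?_
    rw [← N.cTot_mul_p]; ring
  have h2 : ∀ y ∈ s, N.cTot y * f y * N.op g y
      = ∑ x ∈ s.biUnion N.nb, N.c x y * f y * g x := by
    intro y hy
    rw [op_apply, Finset.mul_sum]
    rw [← Finset.sum_subset (Finset.subset_biUnion_of_mem N.nb hy)]
    · refine Finset.sum_congr rfl fun x _ => ?_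
      rw [N.symm x y, ← N.cTot_mul_p]; ring
    · intro x _ hx
      rw [N.symm, N.c_eq_zero hx]; simp
  rw [Finset.sum_congr rfl h2, Finset.sum_congr rfl fun x _ => h1 x, Finset.sum_comm]

lemma pr_kill (o : V) (f g : V → ℝ) : N.pr (kill o f) g = N.pr f (kill o g) := by
  unfold pr
  congr 1; ext x
  simp only [kill_apply]; split_ifs <;> simp

lemma pr_Q_K (o : V) {f : V → ℝ} (hf : FS f) (g : V → ℝ) :
    N.pr (N.Q o f) g = N.pr f (N.K o g) := by
  change N.pr (kill o (N.op f)) g = _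
  rw [pr_kill, pr_op N hf, K_apply]

lemma pr_Q_K_pow (o : V) {f : V → ℝ} (hf : FS f) (n : ℕ) : ∀ (g : V → ℝ),
    N.pr ((N.Q o ^ n) f) g = N.pr f ((N.K o ^ n) g) := by
  induction n with
  | zero => intro g; simp
  | succ n ih =>
    intro g
    rw [pow_succ', Module.End.mul_apply, N.pr_Q_K o (N.FS_Q_pow o hf n), ih, pow_succ,
      Module.End.mul_apply]

lemma Q_pow_zero (o : V) {f : V → ℝ} (hf : f o = 0) (n : ℕ) : (N.Q o ^ n) f o = 0 := by
  induction n with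
  | zero => simpa using hf
  | succ n ih =>
    rw [pow_succ', Module.End.mul_apply]; simp [Q_apply]

lemma kill_eq (o : V) {f : V → ℝ} (hf : f o = 0) : kill o f = f := by
  ext x; simp only [kill_apply]; split_ifs with h
  · rw [h, hf]
  · rfl

lemma pr_Q_Q (o : V) {f : V → ℝ} (hf : FS f) (hf0 : f o = 0) {g : V → ℝ} (hg0 : g o = 0) :
    N.pr (N.Q o f) g = N.pr f (N.Q o g) := by
  rw [N.pr_Q_K o hf]
  change _ = N.pr f (kill o (N.op g))
  rw [← pr_kill, kill_eq o hf0, K_apply, kill_eq o hg0]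

lemma pr_Q_Q_pow (o : V) {f : V → ℝ} (hf : FS f) (hf0 : f o = 0) (n : ℕ) :
    ∀ {g : V → ℝ}, g o = 0 → N.pr ((N.Q o ^ n) f) g = N.pr f ((N.Q o ^ n) g) := by
  induction n with
  | zero => intro g hg; simp
  | succ n ih =>
    intro g hg
    rw [pow_succ', Module.End.mul_apply, N.pr_Q_Q o (N.FS_Q_pow o hf n) (N.Q_pow_zero o hf0 n) hg,
      ih (by simp [Q_apply]), ← Module.End.mul_apply, ← pow_succ, pow_succ']

lemma pr_dl_left (o : V) (g : V → ℝ) : N.pr (dl o) g = N.cTot o * g o := by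
  rw [N.pr_eq_sum g {o} (fun x hx => by simpa [dl] using hx)]; simp [dl]

lemma pr_dl_right (v : V) (f : V → ℝ) : N.pr f (dl v) = N.cTot v * f v := by
  unfold pr
  rw [tsum_eq_single v (fun x hx => by simp [dl, hx])]; simp [dl]

lemma pr_tendsto {f : V → ℝ} (hf : FS f) {g : ℕ → V → ℝ} {g' : V → ℝ}
    (hg : ∀ x, Tendsto (fun n => g n x) atTop (𝓝 (g' x))) :
    Tendsto (fun n => N.pr f (g n)) atTop (𝓝 (N.pr f g')) := by
  obtain ⟨s, hs⟩ := hf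
  simp only [fun g => N.pr_eq_sum g s hs]
  exact tendsto_finsetSum _ fun y _ => (hg y).const_mul _

lemma pr_add {f : V → ℝ} (hf : FS f) (g g' : V → ℝ) :
    N.pr f (g + g') = N.pr f g + N.pr f g' := by
  obtain ⟨s, hs⟩ := hf
  simp only [fun g => N.pr_eq_sum g s hs, Pi.add_apply, mul_add, Finset.sum_add_distrib]

lemma pr_smul {f : V → ℝ} (a : ℝ) (g : V → ℝ) :
    N.pr f (a • g) = a * N.pr f g := by
  unfold pr
  rw [← tsum_mul_left]
  congr 1; ext x; simp; ring

lemma pr_zero (f : V → ℝ) : N.pr f 0 = 0 := by simp [pr]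

/-- `pstep` in terms of the operator. -/
lemma pstep_eq (o : V) (n : ℕ) : ∀ y, N.pstep n o y = N.cTot y / N.cTot o * (N.op ^ n) (dl o) y := by
  induction n with
  | zero =>
    intro y
    have := (N.cTot_pos o).ne'
    simp only [pstep, pow_zero, Module.End.one_apply, dl]
    by_cases h : y = o
    · subst h; simp [this]
    · simp [h, Ne.symm h]
  | succ n ih =>
    intro y
    have h0 := (N.cTot_pos o).ne'
    have hy := (N.cTot_pos y).ne'
    rw [pstep, pow_succ', Module.End.mul_apply, op_apply, Finset.mul_sum]
    rw [tsum_eq_sum (s := N.nb y)]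
    · refine Finset.sum_congr rfl fun z _ => ?_
      have hz := (N.cTot_pos z).ne'
      rw [ih, p, p, N.symm z y]
      field_simp
    · intro z hz
      rw [p, N.symm, N.c_eq_zero hz]; simp

lemma op_pow_nonneg {f : V → ℝ} (hf : ∀ x, 0 ≤ f x) (n : ℕ) : ∀ x, 0 ≤ (N.op ^ n) f x := by
  induction n with
  | zero => simpa using hf
  | succ n ih => rw [pow_succ']; exact N.op_nonneg ih

lemma Q_nonneg (o : V) {f : V → ℝ} (hf : ∀ x, 0 ≤ f x) (x : V) : 0 ≤ N.Q o f x := by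
  rw [Q_apply]; split_ifs
  · exact le_rfl
  · exact N.op_nonneg hf x

lemma Q_pow_nonneg (o : V) {f : V → ℝ} (hf : ∀ x, 0 ≤ f x) (n : ℕ) :
    ∀ x, 0 ≤ (N.Q o ^ n) f x := by
  induction n with
  | zero => simpa using hf
  | succ n ih => rw [pow_succ']; exact N.Q_nonneg o ih

lemma K_nonneg (o : V) {f : V → ℝ} (hf : ∀ x, 0 ≤ f x) (x : V) : 0 ≤ N.K o f x := by
  rw [K_apply]
  refine N.op_nonneg (fun y => ?_) x
  rw [kill_apply]; split_ifs
  · exact le_rfl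
  · exact hf y

lemma K_pow_nonneg (o : V) {f : V → ℝ} (hf : ∀ x, 0 ≤ f x) (n : ℕ) :
    ∀ x, 0 ≤ (N.K o ^ n) f x := by
  induction n with
  | zero => simpa using hf
  | succ n ih => rw [pow_succ']; exact N.K_nonneg o ih

lemma dl_nonneg (o x : V) : 0 ≤ dl o x := by unfold dl; split_ifs <;> simp

lemma Q_pow_le_op_pow (o : V) {f : V → ℝ} (hf : ∀ x, 0 ≤ f x) (n : ℕ) :
    ∀ x, (N.Q o ^ n) f x ≤ (N.op ^ n) f x := by
  induction n with
  | zero => simp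
  | succ n ih =>
    intro x
    rw [pow_succ', pow_succ', Module.End.mul_apply, Module.End.mul_apply, Q_apply]
    split_ifs
    · exact N.op_nonneg (N.op_pow_nonneg hf n) x
    · exact N.op_mono ih x

/-- Partial sums of the hitting probabilities of `o`. -/
noncomputable def B (o : V) (n : ℕ) : V → ℝ := ∑ k ∈ Finset.range n, (N.Q o ^ k) (dl o)

lemma B_succ (o : V) (n : ℕ) : N.B o (n + 1) = dl o + N.Q o (N.B o n) := by
  unfold B
  rw [Finset.sum_range_succ', map_sum, add_comm]
  simp [pow_succ', Module.End.mul_apply]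

lemma B_le_one (o : V) (n : ℕ) : ∀ x, N.B o n x ≤ 1 := by
  induction n with
  | zero => simp [B]
  | succ n ih =>
    intro x
    rw [B_succ, Pi.add_apply, Q_apply, dl]
    split_ifs
    · simp
    · simpa using N.op_le_one ih x

lemma B_mono (o : V) (x : V) : Monotone fun n => N.B o n x := by
  refine monotone_nat_of_le_succ fun n => ?_
  unfold B
  rw [Finset.sum_range_succ, Pi.add_apply]
  linarith [N.Q_pow_nonneg o (dl_nonneg o) n x]

lemma B_tendsto (hrec : N.Recurrent) (o x : V) :
    Tendsto (fun n => N.B o n x) atTop (𝓝 1) := by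
  have hlim : ∀ x, Tendsto (fun n => N.B o n x) atTop (𝓝 (⨆ n, N.B o n x)) := fun x =>
    tendsto_atTop_ciSup (N.B_mono o x) ⟨1, by rintro _ ⟨n, rfl⟩; exact N.B_le_one o n x⟩
  set β : V → ℝ := fun x => ⨆ n, N.B o n x with hβ
  have hβ1 : ∀ x, β x ≤ 1 := fun x => le_of_tendsto' (hlim x) fun n => N.B_le_one o n x
  have hβ0 : ∀ x, 0 ≤ β x := fun x => by
    refine ge_of_tendsto' (hlim x) fun n => ?_
    have := N.B_mono o x (Nat.zero_le n)
    simpa [B] using this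
  have hβeq : β = dl o + N.Q o β := by
    ext x
    refine tendsto_nhds_unique ((tendsto_add_atTop_iff_nat 1).2 (hlim x)) ?_
    simp only [B_succ, Pi.add_apply]
    exact (kill_tendsto o (N.op_tendsto hlim) x).const_add _
  set r : V → ℝ := (fun _ => (1 : ℝ)) - β with hr
  have hr0 : ∀ x, 0 ≤ r x := fun x => by simp [hr, hβ1 x]
  have hr1 : ∀ x, r x ≤ 1 := fun x => by simp [hr, hβ0 x]
  have hro : r o = 0 := by
    have := congrFun hβeq o
    simp [Q_apply, dl] at this
    simp [hr, this]
  have hrop : ∀ x, x ≠ o → N.op r x = r x := by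
    intro x hx
    have := congrFun hβeq x
    simp [Q_apply, dl, hx] at this
    rw [hr, map_sub, Pi.sub_apply, Pi.sub_apply, N.op_one, this]
  set ρ := N.op r o with hρ
  have hρ0 : 0 ≤ ρ := N.op_nonneg hr0 o
  have hopr : N.op r = r + ρ • dl o := by
    ext x
    by_cases hx : x = o
    · subst hx; simp [hro, dl, hρ]
    · simp [hrop x hx, dl, hx]
  have hpow : ∀ n, (N.op ^ n) r = r + ρ • ∑ k ∈ Finset.range n, (N.op ^ k) (dl o) := by
    intro n
    induction n with
    | zero => simp
    | succ n ih =>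
      rw [pow_succ, Module.End.mul_apply, hopr, map_add, map_smul, ih, Finset.sum_range_succ,
        smul_add, add_assoc]
  have hpow1 : ∀ n x, (N.op ^ n) r x ≤ 1 := by
    intro n
    induction n with
    | zero => simpa using hr1
    | succ n ih => rw [pow_succ']; exact N.op_le_one ih
  have hρz : ρ = 0 := by
    by_contra hne
    have hρp : 0 < ρ := lt_of_le_of_ne hρ0 (Ne.symm hne)
    apply hrec o
    refine summable_of_sum_range_le (c := 1 / ρ) (fun n => ?_) fun n => ?_
    · rw [N.pstep_eq]
      exact mul_nonneg (div_nonneg (N.cTot_pos o).le (N.cTot_pos o).le)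
        (N.op_pow_nonneg (dl_nonneg o) n o)
    · have h1 := hpow1 n o
      rw [hpow n, Pi.add_apply, hro, zero_add, Pi.smul_apply, Finset.sum_apply, smul_eq_mul] at h1
      rw [le_div_iff₀ hρp, mul_comm]
      refine le_trans (le_of_eq ?_) h1
      congr 1
      refine Finset.sum_congr rfl fun k _ => ?_
      rw [N.pstep_eq, div_self (N.cTot_pos o).ne', one_mul]
  have hopr' : ∀ x, N.op r x = r x := by intro x; rw [hopr, hρz]; simp
  have hzero : r x = 0 := by
    have hconn := N.conn o x
    induction hconn with
    | refl => exact hro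
    | @tail a b hab hb ih =>
      have h1 := hopr' a
      rw [ih, op_apply, Finset.sum_eq_zero_iff_of_nonneg
        (fun y _ => mul_nonneg (N.p_nonneg a y) (hr0 y))] at h1
      have h2 := h1 b (N.mem_nb.2 hb)
      exact (mul_eq_zero.1 h2).resolve_left (N.p_pos (N.mem_nb.2 hb)).ne'
  have : β x = 1 := by simp [hr] at hzero; linarith
  rw [← this]; exact hlim x

end Op
end Network

namespace Network

section Est
variable {V : Type*} (N : Network V)

/-- Probability to hit `v` within `k` steps, before `o`. -/
noncomputable def fk (o v : V) : ℕ → V → ℝ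
  | 0 => dl v
  | k + 1 => fun y => if y = v then 1 else if y = o then 0 else N.op (fk o v k) y

lemma fk_nonneg (o v : V) (k : ℕ) : ∀ y, 0 ≤ N.fk o v k y := by
  induction k with
  | zero => exact dl_nonneg v
  | succ k ih =>
    intro y
    simp only [fk]; split_ifs
    · exact zero_le_one
    · exact le_rfl
    · exact N.op_nonneg ih y

lemma fk_le_one (o v : V) (k : ℕ) : ∀ y, N.fk o v k y ≤ 1 := by
  induction k with
  | zero => intro y; simp only [fk, dl]; split_ifs <;> simp
  | succ k ih =>
    intro y
    simp only [fk]; split_ifs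
    · exact le_rfl
    · exact zero_le_one
    · exact N.op_le_one ih y

lemma fk_mono (o v y : V) : Monotone fun k => N.fk o v k y := by
  refine monotone_nat_of_le_succ fun k => ?_
  induction k generalizing y with
  | zero =>
    by_cases h : y = v
    · simp [fk, dl, h]
    · simpa [fk, dl, h] using N.fk_nonneg o v 1 y
  | succ k ih =>
    simp only [fk] at ih ⊢
    split_ifs
    · exact le_rfl
    · exact le_rfl
    · exact N.op_mono ih y

/-- Probability to hit `v` before `o`. -/
noncomputable def fl (o v : V) : V → ℝ := fun y => ⨆ k, N.fk o v k y

lemma fl_tendsto (o v y : V) : Tendsto (fun k => N.fk o v k y) atTop (𝓝 (N.fl o v y)) :=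
  tendsto_atTop_ciSup (N.fk_mono o v y) ⟨1, by rintro _ ⟨n, rfl⟩; exact N.fk_le_one o v n y⟩

lemma fl_nonneg (o v y : V) : 0 ≤ N.fl o v y :=
  ge_of_tendsto' (N.fl_tendsto o v y) fun k => N.fk_nonneg o v k y

lemma fl_le_one (o v y : V) : N.fl o v y ≤ 1 :=
  le_of_tendsto' (N.fl_tendsto o v y) fun k => N.fk_le_one o v k y

lemma fk_le_fl (o v : V) (k : ℕ) (y : V) : N.fk o v k y ≤ N.fl o v y :=
  (N.fk_mono o v y).ge_of_tendsto (N.fl_tendsto o v y) k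

lemma fl_eq (o v y : V) :
    N.fl o v y = if y = v then 1 else if y = o then 0 else N.op (N.fl o v) y := by
  refine tendsto_nhds_unique ((tendsto_add_atTop_iff_nat 1).2 (N.fl_tendsto o v y)) ?_
  simp only [fk]
  split_ifs
  · exact tendsto_const_nhds
  · exact tendsto_const_nhds
  · exact N.op_tendsto (N.fl_tendsto o v) y

/-- Escape probability. -/
noncomputable def kap (o v : V) : ℝ := 1 - N.op (N.fl o v) v

lemma kap_nonneg (o v : V) : 0 ≤ N.kap o v := by
  have := N.op_le_one (N.fl_le_one o v) v
  unfold kap; linarith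

lemma Q_fl (o v : V) (hv : v ≠ o) : N.Q o (N.fl o v) = N.fl o v + (-N.kap o v) • dl v := by
  ext y
  rw [Q_apply, Pi.add_apply, N.fl_eq o v y, Pi.smul_apply, smul_eq_mul, dl, kap]
  by_cases h1 : y = v
  · subst h1; simp [hv]
  · by_cases h2 : y = o
    · subst h2; simp [Ne.symm hv]
    · simp [h1, h2]

lemma Q_pow_fl (o v : V) (hv : v ≠ o) (n : ℕ) : (N.Q o ^ n) (N.fl o v)
    = N.fl o v + (-N.kap o v) • ∑ i ∈ Finset.range n, (N.Q o ^ i) (dl v) := by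
  induction n with
  | zero => simp
  | succ n ih =>
    rw [pow_succ, Module.End.mul_apply, Q_fl N o v hv, map_add, map_smul, ih,
      Finset.sum_range_succ, smul_add, add_assoc]

lemma fl_o (o v : V) (hv : v ≠ o) : N.fl o v o = 0 := by
  rw [fl_eq]; simp [Ne.symm hv]

lemma Q_pow_fl_tendsto (hrec : N.Recurrent) (o v : V) (hv : v ≠ o) (x : V) :
    Tendsto (fun n => (N.Q o ^ n) (N.fl o v) x) atTop (𝓝 0) := by
  have hq : ∀ n x, (N.Q o ^ n) (N.fl o v) x ≤ 1 - N.B o (n + 1) x := by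
    intro n
    induction n with
    | zero =>
      intro x
      by_cases hx : x = o
      · subst hx; simp [B, dl, fl_o N _ v hv]
      · simpa [B, dl, hx] using N.fl_le_one o v x
    | succ n ih =>
      intro x
      rw [pow_succ', Module.End.mul_apply, B_succ, Pi.add_apply, Q_apply, Q_apply, dl]
      split_ifs
      · simp
      · have := N.op_mono (g := (fun _ => (1 : ℝ)) - N.B o (n + 1)) ih x
        rw [map_sub, Pi.sub_apply, op_one] at this
        linarith
  have hB := (tendsto_add_atTop_iff_nat 1).2 (N.B_tendsto hrec o x)
  have hB' := hB.const_sub 1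
  rw [sub_self] at hB'
  exact squeeze_zero (fun n => N.Q_pow_nonneg o (N.fl_nonneg o v) n x) (fun n => hq n x) hB'

lemma pr_fl_tendsto (hrec : N.Recurrent) (o v : V) (hv : v ≠ o) {φ : V → ℝ} (hφ : FS φ)
    (hφ0 : φ o = 0) :
    Tendsto (fun n => N.kap o v * N.cTot v * ∑ i ∈ Finset.range n, (N.Q o ^ i) φ v) atTop
      (𝓝 (N.pr φ (N.fl o v))) := by
  have h1 : ∀ n, N.kap o v * N.cTot v * ∑ i ∈ Finset.range n, (N.Q o ^ i) φ v
      = N.pr φ (N.fl o v) - N.pr φ ((N.Q o ^ n) (N.fl o v)) := by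
    intro n
    have h2 : N.pr φ (∑ i ∈ Finset.range n, (N.Q o ^ i) (dl v))
        = N.cTot v * ∑ i ∈ Finset.range n, (N.Q o ^ i) φ v := by
      induction n with
      | zero => simp [pr_zero]
      | succ n ih =>
        rw [Finset.sum_range_succ, Finset.sum_range_succ, N.pr_add hφ, ih, mul_add,
          ← N.pr_Q_Q_pow o hφ hφ0 n (by simp [dl, Ne.symm hv]), pr_dl_right]
    rw [N.Q_pow_fl o v hv, N.pr_add hφ, pr_smul, h2]
    ring
  simp only [h1]
  have h3 := (N.pr_tendsto hφ (g' := 0) (N.Q_pow_fl_tendsto hrec o v hv)).const_sub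
    (N.pr φ (N.fl o v))
  rwa [pr_zero, sub_zero] at h3

lemma op_h {o : V} {h : V → ℝ} (hpot : N.IsPotential o h) {x : V} (hx : x ≠ o) :
    N.op h x = h x := by
  have h1 := hpot.2.2.2 x hx
  rw [lap, tsum_eq_sum (s := N.nb x) (fun y hy => by rw [N.c_eq_zero hy, zero_mul])] at h1
  simp only [mul_sub, Finset.sum_sub_distrib, ← Finset.sum_mul] at h1
  rw [← cTot_eq] at h1
  have h2 : N.cTot x * N.op h x = ∑ y ∈ N.nb x, N.c x y * h y := by
    rw [op_apply, Finset.mul_sum]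
    refine Finset.sum_congr rfl fun y _ => ?_
    rw [← N.cTot_mul_p]; ring
  have h3 := (N.cTot_pos x).ne'
  apply mul_left_cancel₀ h3
  linarith

/-- Hitting distribution restricted to a set. -/
noncomputable def cut (S : Set V) (g : V → ℝ) : V → ℝ := fun x => if x ∈ S then g x else 0

lemma FS_cut (S : Set V) {g : V → ℝ} (hg : FS g) : FS (cut S g) := by
  obtain ⟨s, hs⟩ := hg
  exact ⟨s, fun x hx => by simp [cut, hs x hx]⟩

lemma sum_Q_pow_add (o : V) (j n : ℕ) (x : V) :
    ∑ i ∈ Finset.range n, (N.Q o ^ i) ((N.Q o ^ j) (dl o)) x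
      = N.B o (j + n) x - N.B o j x := by
  unfold B
  rw [Finset.sum_range_add, Pi.add_apply, add_sub_cancel_left, Finset.sum_apply]
  refine Finset.sum_congr rfl fun i _ => ?_
  rw [← Module.End.mul_apply, ← pow_add, add_comm]

lemma B_nonneg (o : V) (n : ℕ) (x : V) : 0 ≤ N.B o n x := by
  have := N.B_mono o x (Nat.zero_le n)
  simpa [B] using this

lemma Q_pow_dl_o (o : V) {j : ℕ} (hj : 0 < j) : (N.Q o ^ j) (dl o) o = 0 := by
  obtain ⟨k, rfl⟩ : ∃ k, j = k + 1 := ⟨j - 1, by omega⟩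
  rw [pow_succ', Module.End.mul_apply]; simp [Q_apply]

lemma cut_le {S : Set V} {g : V → ℝ} (hg : ∀ x, 0 ≤ g x) (x : V) : cut S g x ≤ g x := by
  unfold cut; split_ifs
  · exact le_rfl
  · exact hg x

lemma cut_bound {o : V} {h : V → ℝ} (hpot : N.IsPotential o h) {M : ℝ} (hM : 0 < M)
    {j : ℕ} (hj : 0 < j) (n : ℕ) : ∀ x,
    ∑ i ∈ Finset.range n, (N.Q o ^ i) (cut {x | M ≤ h x} ((N.Q o ^ j) (dl o))) x ≤ h x / M := by
  set b := (N.Q o ^ j) (dl o) with hb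
  have hb0 : ∀ x, 0 ≤ b x := N.Q_pow_nonneg o (dl_nonneg o) j
  induction n with
  | zero => intro x; simpa using div_nonneg (hpot.1 x) hM.le
  | succ n ih =>
    intro x
    by_cases hx : M ≤ h x
    · have h1 : (1 : ℝ) ≤ h x / M := by rwa [le_div_iff₀ hM, one_mul]
      refine le_trans (Finset.sum_le_sum fun i _ =>
        pow_mono (N.Q o) (fun f g hfg => N.Q_mono o hfg) i (g := b) (cut_le hb0) x) ?_
      rw [hb, sum_Q_pow_add]
      linarith [N.B_le_one o (j + (n + 1)) x, N.B_nonneg o j x]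
    · have e : ∑ i ∈ Finset.range (n + 1), (N.Q o ^ i) (cut {x | M ≤ h x} b) x
          = N.Q o (∑ i ∈ Finset.range n, (N.Q o ^ i) (cut {x | M ≤ h x} b)) x := by
        rw [Finset.sum_range_succ', map_sum, Finset.sum_apply]
        simp [pow_succ', Module.End.mul_apply, cut, hx]
      rw [e, Q_apply]
      split_ifs with hxo
      · exact div_nonneg (hpot.1 x) hM.le
      · have h1 := N.op_mono (f := ∑ i ∈ Finset.range n, (N.Q o ^ i) (cut {x | M ≤ h x} b))
          (g := M⁻¹ • h) (fun y => by
            rw [Finset.sum_apply, Pi.smul_apply, smul_eq_mul, mul_comm, ← div_eq_mul_inv]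
            exact ih y) x
        rw [map_smul, Pi.smul_apply, N.op_h hpot hxo, smul_eq_mul, mul_comm,
          ← div_eq_mul_inv] at h1
        exact h1

lemma pstep_pos_iff (o : V) (n : ℕ) (y : V) :
    0 < N.pstep n o y ↔ 0 < (N.op ^ n) (dl o) y := by
  rw [pstep_eq]
  exact mul_pos_iff_of_pos_left (div_pos (N.cTot_pos y) (N.cTot_pos o))

/-- The main analytic estimate. -/
lemma main_est (hrec : N.Recurrent) {o : V} {h : V → ℝ} (hpot : N.IsPotential o h)
    {v : V} (hv : v ≠ o) {M : ℝ} (hM : 0 < M) {j : ℕ} (hj : 0 < j)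
    (hjd : j < sInf {n | 0 < N.pstep n o v}) :
    (N.K o ^ j) (cut {x | M ≤ h x} (N.fl o v)) o ≤ h v / M * (N.K o ^ j) (N.fl o v) o := by
  set b := (N.Q o ^ j) (dl o) with hb
  have hbF : FS b := N.FS_Q_pow o (FS_dl o) j
  have hbo : b o = 0 := N.Q_pow_dl_o o hj
  have hBj : N.B o j v = 0 := by
    unfold B
    rw [Finset.sum_apply]
    refine Finset.sum_eq_zero fun i hi => ?_
    have hi' : i < sInf {n | 0 < N.pstep n o v} := (Finset.mem_range.1 hi).trans hjd
    have h1 : ¬ 0 < N.pstep i o v := Nat.notMem_of_lt_sInf hi'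
    rw [pstep_pos_iff] at h1
    exact le_antisymm ((N.Q_pow_le_op_pow o (dl_nonneg o) i v).trans (not_lt.1 h1))
      (N.Q_pow_nonneg o (dl_nonneg o) i v)
  have hkc : 0 ≤ N.kap o v * N.cTot v := mul_nonneg (N.kap_nonneg o v) (N.cTot_pos v).le
  have e1 : N.pr b (N.fl o v) = N.kap o v * N.cTot v := by
    refine tendsto_nhds_unique (N.pr_fl_tendsto hrec o v hv hbF hbo) ?_
    simp only [hb, sum_Q_pow_add, hBj, sub_zero]
    have h1 : Tendsto (fun n => N.B o (j + n) v) atTop (𝓝 1) := by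
      simp only [add_comm j]
      exact (tendsto_add_atTop_iff_nat j).2 (N.B_tendsto hrec o v)
    simpa using h1.const_mul (N.kap o v * N.cTot v)
  have e2 : N.pr (cut {x | M ≤ h x} b) (N.fl o v) ≤ N.kap o v * N.cTot v * (h v / M) := by
    refine le_of_tendsto' (N.pr_fl_tendsto hrec o v hv (FS_cut _ hbF) (by simp [cut, hbo]))
      fun n => ?_
    exact mul_le_mul_of_nonneg_left (N.cut_bound hpot hM hj n v) hkc
  have e3 : N.pr (cut {x | M ≤ h x} b) (N.fl o v) = N.pr b (cut {x | M ≤ h x} (N.fl o v)) := by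
    unfold pr cut
    congr 1; ext x; split_ifs <;> simp
  rw [e3, hb, N.pr_Q_K_pow o (FS_dl o), pr_dl_left] at e2
  rw [hb, N.pr_Q_K_pow o (FS_dl o), pr_dl_left] at e1
  rw [← e1] at e2
  refine le_of_mul_le_mul_left ?_ (N.cTot_pos o)
  linarith

lemma countable {V : Type*} (N : Network V) (o : V) : Countable V := by
  have hball : ∀ n : ℕ, ∃ s : Finset V, ∀ y, 0 < (N.op ^ n) (dl o) y → y ∈ s := by
    intro n
    have : FS ((N.op ^ n) (dl o)) := by
      induction n with
      | zero => simpa using FS_dl o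
      | succ n ih => rw [pow_succ']; exact N.FS_op ih
    obtain ⟨s, hs⟩ := this
    exact ⟨s, fun y hy => by by_contra hc; rw [hs y hc] at hy; exact lt_irrefl _ hy⟩
  choose s hs using hball
  have hu : (Set.univ : Set V) = ⋃ n, (s n : Set V) := by
    refine (Set.eq_univ_of_forall fun x => ?_).symm
    have : ∃ n, 0 < (N.op ^ n) (dl o) x := by
      have hconn := N.conn o x
      induction hconn with
      | refl => exact ⟨0, by simp [dl]⟩
      | @tail a b _ hb ih =>
        obtain ⟨n, hn⟩ := ih
        refine ⟨n + 1, ?_⟩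
        rw [pow_succ', Module.End.mul_apply, op_apply]
        have hab : a ∈ N.nb b := by rw [mem_nb, N.symm]; exact hb
        exact Finset.sum_pos' (fun y _ => mul_nonneg (N.p_nonneg b y)
          (N.op_pow_nonneg (dl_nonneg o) n y)) ⟨a, hab, mul_pos (N.p_pos hab) hn⟩
    obtain ⟨n, hn⟩ := this
    exact Set.mem_iUnion.2 ⟨n, hs n x hn⟩
  rw [← Set.countable_univ_iff, hu]
  exact Set.countable_iUnion fun n => (s n).countable_toSet

end Est

section Prob
variable {V : Type*} [MeasurableSpace V] (N : Network V)

/-- Cylinder set. -/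
def cyl (n : ℕ) (w : ℕ → V) : Set (ℕ → V) := {ω | ∀ i ≤ n, ω i = w i}

/-- Weight of a path from `o`. -/
noncomputable def wt (o : V) (n : ℕ) (w : ℕ → V) : ℝ :=
  dl o (w 0) * ∏ i ∈ Finset.range n, N.p (w i) (w (i + 1))

lemma wt_nonneg (o : V) (n : ℕ) (w : ℕ → V) : 0 ≤ N.wt o n w :=
  mul_nonneg (dl_nonneg o _) (Finset.prod_nonneg fun _ _ => N.p_nonneg _ _)

lemma meas_cyl (hms : ∀ s : Set V, MeasurableSet s) (n : ℕ) (w : ℕ → V) :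
    MeasurableSet (cyl n w) := by
  have : cyl n w = ⋂ i, ⋂ (_ : i ≤ n), (fun ω : ℕ → V => ω i) ⁻¹' {w i} := by
    ext ω; simp [cyl]
  rw [this]
  exact MeasurableSet.iInter fun i => MeasurableSet.iInter fun _ =>
    measurable_pi_apply i (hms _)

/-- One step of the Markov property. -/
lemma step [Countable V] (hms : ∀ s : Set V, MeasurableSet s) (o : V)
    (P : Measure (ℕ → V)) {E : Set (ℕ → V)} (hE : MeasurableSet E) (n : ℕ)
    {g : V → ℝ} (hg : ∀ x, 0 ≤ g x)
    (hP : ∀ w, P (cyl (n + 1) w ∩ E) = ENNReal.ofReal (N.wt o (n + 1) w * g (w (n + 1))))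
    (w : ℕ → V) : P (cyl n w ∩ E) = ENNReal.ofReal (N.wt o n w * N.op g (w n)) := by
  have hU : cyl n w ∩ E = ⋃ z : V, cyl (n + 1) (Function.update w (n + 1) z) ∩ E := by
    ext ω
    simp only [cyl, Set.mem_inter_iff, Set.mem_ofPred_eq, Set.mem_iUnion]
    constructor
    · rintro ⟨h1, h2⟩
      refine ⟨ω (n + 1), fun i hi => ?_, h2⟩
      rcases Nat.lt_or_ge n i with h | h
      · obtain rfl : i = n + 1 := by omega
        simp
      · rw [Function.update_of_ne (by omega)]; exact h1 i h
    · rintro ⟨z, h1, h2⟩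
      refine ⟨fun i hi => ?_, h2⟩
      rw [h1 i (by omega), Function.update_of_ne (by omega)]
  have hwt : ∀ z, N.wt o (n + 1) (Function.update w (n + 1) z) = N.wt o n w * N.p (w n) z := by
    intro z
    unfold wt
    rw [Finset.prod_range_succ, Function.update_self, Function.update_of_ne (by omega),
      Function.update_of_ne (by omega), ← mul_assoc]
    congr 2
    refine Finset.prod_congr rfl fun i hi => ?_
    have := Finset.mem_range.1 hi
    rw [Function.update_of_ne (by omega), Function.update_of_ne (by omega)]
  rw [hU, measure_iUnion]
  · simp only [hP, hwt, Function.update_self]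
    rw [tsum_eq_sum (s := N.nb (w n)) (fun z hz => by rw [N.p_eq_zero hz]; simp),
      ← ENNReal.ofReal_sum_of_nonneg]
    · rw [op_apply, Finset.mul_sum]
      congr 1
      exact Finset.sum_congr rfl fun z _ => by ring
    · intro z _
      exact mul_nonneg (mul_nonneg (N.wt_nonneg o n w) (N.p_nonneg _ _)) (hg z)
  · intro z z' hz
    rw [Function.onFun, Set.disjoint_left]
    rintro ω ⟨h1, _⟩ ⟨h2, _⟩
    apply hz
    have e1 := h1 (n + 1) le_rfl
    have e2 := h2 (n + 1) le_rfl
    rw [Function.update_self] at e1 e2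
    rw [← e1, e2]
  · intro z
    exact (meas_cyl hms _ _).inter hE

/-- From time `n`, `v` is hit within `k` steps, before `o`. -/
def Ev (o v : V) (n k : ℕ) : Set (ℕ → V) :=
  {ω | ∃ i ≤ k, ω (n + i) = v ∧ ∀ m ≤ i, ω (n + m) ≠ o}

lemma meas_coord (hms : ∀ s : Set V, MeasurableSet s) (i : ℕ) (S : Set V) :
    MeasurableSet {ω : ℕ → V | ω i ∈ S} := measurable_pi_apply i (hms S)

lemma meas_Ev (hms : ∀ s : Set V, MeasurableSet s) (o v : V) (n k : ℕ) :
    MeasurableSet (Ev o v n k) := by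
  have : Ev o v n k = ⋃ i, ⋃ (_ : i ≤ k), ({ω : ℕ → V | ω (n + i) ∈ ({v} : Set V)} ∩
      ⋂ m, ⋂ (_ : m ≤ i), {ω : ℕ → V | ω (n + m) ∈ ({o} : Set V)ᶜ}) := by
    ext ω; simp only [Ev, Set.mem_iUnion, Set.mem_inter_iff, Set.mem_iInter]; simp [and_left_comm]
  rw [this]
  exact MeasurableSet.iUnion fun i => MeasurableSet.iUnion fun _ =>
    (meas_coord hms _ _).inter
      (MeasurableSet.iInter fun m => MeasurableSet.iInter fun _ => meas_coord hms _ _)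

/-- Avoid `o` for `m` steps after time `n`, be in `S` at time `n + m`, then `Ev`. -/
def Fv (o v : V) (S : Set V) (n m k : ℕ) : Set (ℕ → V) :=
  {ω | (∀ i, 1 ≤ i → i ≤ m → ω (n + i) ≠ o) ∧ ω (n + m) ∈ S ∧ ω ∈ Ev o v (n + m) k}

lemma meas_Fv (hms : ∀ s : Set V, MeasurableSet s) (o v : V) (S : Set V) (n m k : ℕ) :
    MeasurableSet (Fv o v S n m k) := by
  have : Fv o v S n m k = (⋂ i, ⋂ (_ : 1 ≤ i), ⋂ (_ : i ≤ m),
      {ω : ℕ → V | ω (n + i) ∈ ({o} : Set V)ᶜ}) ∩ ({ω : ℕ → V | ω (n + m) ∈ S} ∩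
        Ev o v (n + m) k) := by
    ext ω; simp [Fv]
  rw [this]
  exact (MeasurableSet.iInter fun i => MeasurableSet.iInter fun _ =>
    MeasurableSet.iInter fun _ => meas_coord hms _ _).inter
      ((meas_coord hms _ _).inter (meas_Ev hms _ _ _ _))

lemma prob_Ev [Countable V] (hms : ∀ s : Set V, MeasurableSet s) (o v : V) (hv : v ≠ o)
    (P : Measure (ℕ → V)) (hP : ∀ n w, P (cyl n w) = ENNReal.ofReal (N.wt o n w)) (k : ℕ) :
    ∀ n w, P (cyl n w ∩ Ev o v n k) = ENNReal.ofReal (N.wt o n w * N.fk o v k (w n)) := by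
  have hvcase : ∀ k n w, w n = v → cyl n w ∩ Ev o v n k = cyl n w := by
    intro k n w hw
    refine Set.inter_eq_left.2 fun ω hω => ?_
    have h1 : ω n = v := by rw [hω n le_rfl, hw]
    refine ⟨0, Nat.zero_le _, h1, fun m hm => ?_⟩
    obtain rfl : m = 0 := by omega
    rw [add_zero, h1]; exact hv
  induction k with
  | zero =>
    intro n w
    by_cases hw : w n = v
    · rw [hvcase 0 n w hw, hP]; simp [fk, dl, hw]
    · have : cyl n w ∩ Ev o v n 0 = ∅ := by
        ext ω
        simp only [Set.mem_inter_iff, Set.mem_empty_iff_false, iff_false, not_and]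
        rintro h1 ⟨i, hi, h2, _⟩
        obtain rfl : i = 0 := by omega
        exact hw (by rw [← h1 n le_rfl]; exact h2)
      rw [this]; simp [fk, dl, hw]
  | succ k ih =>
    intro n w
    by_cases hw : w n = v
    · rw [hvcase _ n w hw, hP]; simp [fk, hw]
    · by_cases hwo : w n = o
      · have : cyl n w ∩ Ev o v n (k + 1) = ∅ := by
          ext ω
          simp only [Set.mem_inter_iff, Set.mem_empty_iff_false, iff_false, not_and]
          rintro h1 ⟨i, hi, _, h2⟩
          exact h2 0 (Nat.zero_le _) (by rw [add_zero, h1 n le_rfl, hwo])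
        rw [this]; simp [fk, hwo, Ne.symm hv]
      · have : cyl n w ∩ Ev o v n (k + 1) = cyl n w ∩ Ev o v (n + 1) k := by
          ext ω
          simp only [Set.mem_inter_iff]
          refine and_congr_right fun h1 => ?_
          have hn : ω n = w n := h1 n le_rfl
          constructor
          · rintro ⟨i, hi, h2, h3⟩
            obtain rfl | ⟨i', rfl⟩ : i = 0 ∨ ∃ i', i = i' + 1 := by
              rcases i with _ | i
              · exact Or.inl rfl
              · exact Or.inr ⟨i, rfl⟩
            · exact absurd (by rw [← hn]; exact h2) hw
            · refine ⟨i', by omega, ?_, fun m hm => ?_⟩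
              · rw [← h2]; congr 1; omega
              · have := h3 (m + 1) (by omega)
                rwa [show n + (m + 1) = n + 1 + m by omega] at this
          · rintro ⟨i, hi, h2, h3⟩
            refine ⟨i + 1, by omega, ?_, fun m hm => ?_⟩
            · rw [← h2]; congr 1; omega
            · rcases m with _ | m
              · rw [add_zero, hn]; exact hwo
              · have := h3 m (by omega)
                rwa [show n + (m + 1) = n + 1 + m by omega]
        rw [this, N.step hms o P (meas_Ev hms o v _ _) n (N.fk_nonneg o v k) (ih (n + 1))]
        simp [fk, hw, hwo]

lemma cut_nonneg (S : Set V) {g : V → ℝ} (hg : ∀ x, 0 ≤ g x) (x : V) : 0 ≤ cut S g x := by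
  unfold cut; split_ifs
  · exact hg x
  · exact le_rfl

lemma prob_Fv [Countable V] (hms : ∀ s : Set V, MeasurableSet s) (o v : V) (hv : v ≠ o)
    (P : Measure (ℕ → V)) (hP : ∀ n w, P (cyl n w) = ENNReal.ofReal (N.wt o n w)) (S : Set V)
    (k m : ℕ) : ∀ n w, P (cyl n w ∩ Fv o v S n m k)
      = ENNReal.ofReal (N.wt o n w * (N.K o ^ m) (cut S (N.fk o v k)) (w n)) := by
  induction m with
  | zero =>
    intro n w
    by_cases hw : w n ∈ S
    · have : cyl n w ∩ Fv o v S n 0 k = cyl n w ∩ Ev o v n k := by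
        ext ω
        simp only [Set.mem_inter_iff]
        refine and_congr_right fun h1 => ?_
        have hn : ω n = w n := h1 n le_rfl
        constructor
        · rintro ⟨_, _, h⟩; exact h
        · intro h
          exact ⟨fun i _ _ => by omega, by rw [add_zero, hn]; exact hw, h⟩
      rw [this, N.prob_Ev hms o v hv P hP]
      simp [cut, hw]
    · have : cyl n w ∩ Fv o v S n 0 k = ∅ := by
        ext ω
        simp only [Set.mem_inter_iff, Set.mem_empty_iff_false, iff_false, not_and]
        rintro h1 ⟨_, h, _⟩
        rw [add_zero, h1 n le_rfl] at h
        exact hw h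
      rw [this]; simp [cut, hw]
  | succ m ih =>
    intro n w
    set g := (N.K o ^ m) (cut S (N.fk o v k)) with hg
    have hg0 : ∀ x, 0 ≤ g x := N.K_pow_nonneg o (cut_nonneg S (N.fk_nonneg o v k)) m
    rw [pow_succ', Module.End.mul_apply, K_apply]
    refine N.step hms o P (meas_Fv hms o v S n (m + 1) k) n (fun x => ?_) (fun w => ?_) w
    · rw [kill_apply]; split_ifs
      · exact le_rfl
      · exact hg0 x
    · by_cases hwo : w (n + 1) = o
      · have : cyl (n + 1) w ∩ Fv o v S n (m + 1) k = ∅ := by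
          ext ω
          simp only [Set.mem_inter_iff, Set.mem_empty_iff_false, iff_false, not_and]
          rintro h1 ⟨h, _, _⟩
          exact h 1 le_rfl (by omega) (by rw [h1 (n + 1) le_rfl, hwo])
        rw [this]; simp [kill_apply, hwo]
      · have : cyl (n + 1) w ∩ Fv o v S n (m + 1) k = cyl (n + 1) w ∩ Fv o v S (n + 1) m k := by
          ext ω
          simp only [Set.mem_inter_iff]
          refine and_congr_right fun h1 => ?_
          have hn : ω (n + 1) = w (n + 1) := h1 (n + 1) le_rfl
          simp only [Fv, Set.mem_ofPred_eq]
          rw [show n + (m + 1) = n + 1 + m by omega]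
          refine and_congr_left fun _ => ?_
          constructor
          · intro h i hi him
            have := h (i + 1) (by omega) (by omega)
            rwa [show n + (i + 1) = n + 1 + i by omega] at this
          · intro h i hi him
            rcases Nat.lt_or_ge 1 i with h2 | h2
            · have := h (i - 1) (by omega) (by omega)
              rwa [show n + 1 + (i - 1) = n + i by omega] at this
            · obtain rfl : i = 1 := by omega
              rw [hn]; exact hwo
        rw [this, ih (n + 1) w]
        simp [kill_apply, hwo, hg]

lemma ae_pos [Countable V] (o : V)
    (P : Measure (ℕ → V)) (hP : ∀ n w, P (cyl n w) = ENNReal.ofReal (N.wt o n w)) :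
    ∀ᵐ ω ∂P, ∀ n, 0 < N.wt o n ω := by
  rw [ae_all_iff]
  intro n
  rw [ae_iff]
  let ext : (Fin (n + 1) → V) → (ℕ → V) := fun w i => if hi : i < n + 1 then w ⟨i, hi⟩ else o
  have hsub : {ω | ¬ 0 < N.wt o n ω} ⊆
      ⋃ w : Fin (n + 1) → V, ⋃ (_ : ¬ 0 < N.wt o n (ext w)), cyl n (ext w) := by
    intro ω hω
    have hext : ∀ i, i ≤ n → ext (fun i => ω i) i = ω i := by
      intro i hi
      simp [ext]; omega
    have hwt : N.wt o n (ext fun i => ω i) = N.wt o n ω := by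
      unfold wt
      rw [hext 0 (Nat.zero_le _)]
      congr 1
      refine Finset.prod_congr rfl fun i hi => ?_
      have := Finset.mem_range.1 hi
      rw [hext i (by omega), hext (i + 1) (by omega)]
    simp only [Set.mem_iUnion]
    refine ⟨fun i => ω i, ?_, fun i hi => (hext i hi).symm⟩
    rw [hwt]; exact hω
  refine measure_mono_null hsub ?_
  refine measure_iUnion_null fun w => measure_iUnion_null fun hw => ?_
  rw [hP, ENNReal.ofReal_eq_zero]
  exact not_lt.1 hw

lemma op_pow_pos_of_wt (o : V) (ω : ℕ → V) (hω : ∀ n, 0 < N.wt o n ω) (n : ℕ) :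
    0 < (N.op ^ n) (dl o) (ω n) := by
  induction n with
  | zero => simpa [wt] using hω 0
  | succ n ih =>
    have h1 := hω (n + 1)
    have h2 : N.wt o (n + 1) ω = N.wt o n ω * N.p (ω n) (ω (n + 1)) := by
      unfold wt; rw [Finset.prod_range_succ, mul_assoc]
    rw [h2] at h1
    have h3 : ω (n + 1) ∈ N.nb (ω n) := by
      by_contra hc
      rw [N.p_eq_zero hc] at h1; simp at h1
    have hab : ω n ∈ N.nb (ω (n + 1)) := by
      rw [mem_nb, N.symm]; exact N.mem_nb.1 h3
    rw [pow_succ', Module.End.mul_apply, op_apply]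
    exact Finset.sum_pos' (fun y _ => mul_nonneg (N.p_nonneg _ y)
      (N.op_pow_nonneg (dl_nonneg o) n y)) ⟨_, hab, mul_pos (N.p_pos hab) ih⟩

lemma prob_F0 [Countable V] (hms : ∀ s : Set V, MeasurableSet s) (o v : V) (hv : v ≠ o)
    (P : Measure (ℕ → V)) (hP : ∀ n w, P (cyl n w) = ENNReal.ofReal (N.wt o n w)) (S : Set V)
    (k m : ℕ) : P (Fv o v S 0 m k)
      = ENNReal.ofReal ((N.K o ^ m) (cut S (N.fk o v k)) o) := by
  have h1 := N.prob_Fv hms o v hv P hP S k m 0 (fun _ => o)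
  have h2 : N.wt o 0 (fun _ => o) = 1 := by simp [wt, dl]
  rw [h2, one_mul] at h1
  rw [← h1]
  refine measure_congr ?_
  filter_upwards [N.ae_pos o P hP] with ω hω
  have h3 : ω 0 = o := by
    have := hω 0
    by_contra hc
    simp [wt, dl, hc] at this
  refine propext ?_
  change ω ∈ Fv o v S 0 m k ↔ ω ∈ cyl 0 (fun _ => o) ∩ Fv o v S 0 m k
  rw [Set.mem_inter_iff]
  refine ⟨fun h => ⟨fun i hi => ?_, h⟩, fun h => h.2⟩
  obtain rfl : i = 0 := by omega
  exact h3

end Prob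
end Network

/-- Conditioned walk estimate: for a potential `h`, a vertex `v ≠ o`,
`M > 0` and `0 < j < d(o,v)`, the walk from `o` conditioned to hit `v` before returning
to `o` satisfies `P_o(h(X_j) ≥ M | τ_v < τ_o^+) ≤ h(v)/M`. -/
theorem conditioned_walk_estimate {V : Type*} [MeasurableSpace V]
    (hms : ∀ s : Set V, MeasurableSet s)
    (N : Network V) (hrec : N.Recurrent) (o : V) (h : V → ℝ) (hpot : N.IsPotential o h)
    (v : V) (hv : v ≠ o) (M : ℝ) (hM : 0 < M)
    (j : ℕ) (hj0 : 0 < j) (hjd : j < sInf {n | 0 < N.pstep n o v})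
    (P : MeasureTheory.Measure (ℕ → V)) [MeasureTheory.IsProbabilityMeasure P]
    (hchain : IsChainLaw (fun x => if x = o then 1 else 0) N.p P) :
    (P[|{ω | ∃ n, ω n = v ∧ ∀ m, 1 ≤ m → m ≤ n → ω m ≠ o}]) {ω | M ≤ h (ω j)}
      ≤ ENNReal.ofReal (h v / M) := by
  haveI : Countable V := N.countable o
  have hP : ∀ n w, P (Network.cyl n w) = ENNReal.ofReal (N.wt o n w) := fun n w => hchain n w
  set A : Set (ℕ → V) := {ω | ∃ n, ω n = v ∧ ∀ m, 1 ≤ m → m ≤ n → ω m ≠ o} with hA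
  set S : Set V := {x | M ≤ h x} with hS
  have hAm : MeasurableSet A := by
    have : A = ⋃ n, ({ω : ℕ → V | ω n ∈ ({v} : Set V)} ∩
        ⋂ m, ⋂ (_ : 1 ≤ m), ⋂ (_ : m ≤ n), {ω : ℕ → V | ω m ∈ ({o} : Set V)ᶜ}) := by
      ext ω; simp [hA]
    rw [this]
    exact MeasurableSet.iUnion fun n => (Network.meas_coord hms _ _).inter
      (MeasurableSet.iInter fun m => MeasurableSet.iInter fun _ => MeasurableSet.iInter fun _ =>
        Network.meas_coord hms _ _)
  set a := (N.K o ^ j) (N.fl o v) o with ha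
  have hhv : 0 ≤ h v / M := div_nonneg (hpot.1 v) hM.le
  -- lower bound on `P A`
  have hlow : ENNReal.ofReal a ≤ P A := by
    have ht : Tendsto (fun k => ENNReal.ofReal ((N.K o ^ j) (N.fk o v k) o)) atTop
        (𝓝 (ENNReal.ofReal a)) :=
      (ENNReal.continuous_ofReal.tendsto _).comp (N.K_pow_tendsto o (N.fl_tendsto o v) j o)
    refine le_of_tendsto' ht fun k => ?_
    have h1 := N.prob_F0 hms o v hv P hP Set.univ k j
    have h2 : Network.cut Set.univ (N.fk o v k) = N.fk o v k := by ext x; simp [Network.cut]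
    rw [h2] at h1
    rw [← h1]
    refine measure_mono ?_
    rintro ω ⟨h3, -, i, -, h4, h5⟩
    rw [zero_add] at h4
    refine ⟨j + i, h4, fun m hm1 hm2 => ?_⟩
    rcases Nat.lt_or_ge j m with hlt | hge
    · have := h5 (m - j) (by omega)
      rwa [show 0 + j + (m - j) = m by omega] at this
    · have := h3 m hm1 hge
      rwa [zero_add] at this
  -- upper bound on the intersection
  have hup : P (A ∩ {ω | M ≤ h (ω j)}) ≤ ENNReal.ofReal ((N.K o ^ j) (Network.cut S (N.fl o v)) o) := by
    have h1 : P (A ∩ {ω | M ≤ h (ω j)}) ≤ P (⋃ k, Network.Fv o v S 0 j k) := by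
      refine measure_mono_ae ?_
      filter_upwards [N.ae_pos o P hP] with ω hω
      rintro ⟨⟨n, hn, hno⟩, hωS⟩
      have hnj : j < n := by
        have h2 := N.op_pow_pos_of_wt o ω hω n
        rw [hn, ← N.pstep_pos_iff] at h2
        exact lt_of_lt_of_le hjd (Nat.sInf_le h2)
      refine Set.mem_iUnion.2 ⟨n, ?_, ?_, n - j, by omega, ?_, ?_⟩
      · intro i hi hij
        rw [zero_add]; exact hno i hi (by omega)
      · rw [zero_add]; exact hωS
      · rw [show 0 + j + (n - j) = n by omega]; exact hn
      · intro m hm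
        exact hno _ (by omega) (by omega)
    refine h1.trans ?_
    have hmono : Monotone fun k => Network.Fv o v S 0 j k := by
      rintro k k' hk ω ⟨h3, h4, i, hi, h5⟩
      exact ⟨h3, h4, i, hi.trans hk, h5⟩
    rw [hmono.measure_iUnion]
    refine iSup_le fun k => ?_
    rw [N.prob_F0 hms o v hv P hP]
    refine ENNReal.ofReal_le_ofReal ?_
    refine Network.pow_mono (N.K o) (fun f g hfg => N.K_mono o hfg) j (fun x => ?_) o
    unfold Network.cut
    split_ifs
    · exact N.fk_le_fl o v k x
    · exact le_rfl
  have hest : P (A ∩ {ω | M ≤ h (ω j)}) ≤ ENNReal.ofReal (h v / M) * P A := by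
    refine hup.trans ((ENNReal.ofReal_le_ofReal
      (N.main_est hrec hpot hv hM hj0 hjd)).trans ?_)
    rw [ENNReal.ofReal_mul hhv]
    gcongr
  rw [ProbabilityTheory.cond_apply hAm]
  by_cases hz : P A = 0
  · have : P (A ∩ {ω | M ≤ h (ω j)}) = 0 := measure_mono_null Set.inter_subset_left hz
    rw [this, mul_zero]; exact bot_le
  · calc (P A)⁻¹ * P (A ∩ {ω | M ≤ h (ω j)})
        ≤ (P A)⁻¹ * (ENNReal.ofReal (h v / M) * P A) := by gcongr
      _ = ENNReal.ofReal (h v / M) := by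
        rw [mul_comm, mul_assoc, ENNReal.mul_inv_cancel hz (measure_ne_top P A), mul_one]
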